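/- arXiv:1702.03356 — 3 statements merged into one kernel-verified Lean document; each statement's English description precedes it below -/
import Mathlib

section
/- Let K be an infinite field and A a finite-dimensional K-algebra such that every simple A-module is 1-dimensional over K. Then A is isomorphic as a K-algebra to the incidence algebra I(P,K) of some finite partial order P if and only if A admits a faithful finite-dimensional thin module. -/
/-!
STATEMENT 12: Let `K` be an infinite field and `A` a finite-dimensional `K`-algebra
all of whose simple modules are 1-dimensional over `K`.  Then `A` is isomorphic as a
`K`-algebra to the incidence algebra of some finite partial order if and only if `A`
admits a faithful finite-dimensional thin module.
-/

universe u v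

/-- A module is thin (squarefree) if it has finite length and no chain
`N₀ ≤ N₁ ≤ N₂ ≤ N₃` of submodules has `N₁/N₀` and `N₃/N₂` simple and isomorphic. -/
def IsThinModule (R : Type*) [Ring R] (M : Type*) [AddCommGroup M] [Module R M] : Prop :=
  IsFiniteLength R M ∧
    ∀ N₀ N₁ N₂ N₃ : Submodule R M, N₀ ≤ N₁ → N₁ ≤ N₂ → N₂ ≤ N₃ →
      IsSimpleModule R (↥N₁ ⧸ Submodule.comap N₁.subtype N₀) →
      IsSimpleModule R (↥N₃ ⧸ Submodule.comap N₃.subtype N₂) →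
      IsEmpty ((↥N₁ ⧸ Submodule.comap N₁.subtype N₀) ≃ₗ[R]
        (↥N₃ ⧸ Submodule.comap N₃.subtype N₂))

open Module

/-- A module of finite length on which a complete family of elements acts with images in lines
is thin. -/
lemma isThinModule_of_sum_eq_one {K A M ι : Type*} [Field K] [Ring A] [Algebra K A]
    [AddCommGroup M] [Module K M] [Module A M] [IsScalarTower K A M] [Fintype ι]
    (hM : IsFiniteLength A M) (e : ι → A) (he : ∑ i, e i = 1) (v : ι → M)
    (hv : ∀ i m, ∃ c : K, e i • m = c • v i) : IsThinModule A M := by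
  refine ⟨hM, fun N₀ N₁ N₂ N₃ _ h₁₂ _ hs _ ↦ ⟨fun f ↦ ?_⟩⟩
  have hnt := IsSimpleModule.nontrivial A (↥N₁ ⧸ Submodule.comap N₁.subtype N₀)
  obtain ⟨s, hs0⟩ := exists_ne (0 : ↥N₁ ⧸ Submodule.comap N₁.subtype N₀)
  obtain ⟨i, hi⟩ : ∃ i, e i • s ≠ 0 := by
    by_contra! h
    apply hs0
    rw [← one_smul A s, ← he, Finset.sum_smul]
    exact Finset.sum_eq_zero fun i _ ↦ h i
  have hi' : e i • f s ≠ 0 := by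
    rwa [← map_smul, ne_eq, EmbeddingLike.map_eq_zero_iff]
  obtain ⟨x, rfl⟩ := Submodule.Quotient.mk_surjective _ s
  obtain ⟨y, hy⟩ := Submodule.Quotient.mk_surjective _ (f (Submodule.Quotient.mk x))
  rw [← hy, ← Submodule.Quotient.mk_smul, ne_eq, Submodule.Quotient.mk_eq_zero] at hi'
  rw [← Submodule.Quotient.mk_smul, ne_eq, Submodule.Quotient.mk_eq_zero] at hi
  simp only [Submodule.mem_comap, Submodule.subtype_apply, Submodule.coe_smul] at hi hi'
  obtain ⟨c, hc⟩ := hv i (x : M)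
  obtain ⟨d, hd⟩ := hv i (y : M)
  have hc0 : c ≠ 0 := by
    rintro rfl
    exact hi (by rw [hc, zero_smul]; exact N₀.zero_mem)
  apply hi'
  have : (d * c⁻¹) • (e i • (x : M)) ∈ N₁ :=
    N₁.smul_of_tower_mem _ (N₁.smul_mem _ x.2)
  rw [hc, smul_smul, mul_assoc, inv_mul_cancel₀ hc0, mul_one, ← hd] at this
  exact h₁₂ this

section IncidenceMatrix

variable {K P : Type*} [Field K] [PartialOrder P] [Fintype P] [LocallyFiniteOrder P]

lemma IncidenceAlgebra.mul_apply_univ (f g : IncidenceAlgebra K P) (x y : P) :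
    (f * g) x y = ∑ z, f x z * g z y := by
  rw [IncidenceAlgebra.mul_apply]
  refine Finset.sum_subset (Finset.subset_univ _) fun z _ hz ↦ ?_
  rw [Finset.mem_Icc, not_and_or] at hz
  rcases hz with h | h <;> simp [IncidenceAlgebra.apply_eq_zero_of_not_le h]

variable [DecidableEq P]

/-- The inclusion of an incidence algebra into the full matrix algebra. -/
def IncidenceAlgebra.toMatrix : IncidenceAlgebra K P →ₐ[K] Matrix P P K :=
  AlgHom.ofLinearMap
    { toFun := fun f ↦ Matrix.of fun x y ↦ f x y
      map_add' := fun _ _ ↦ rfl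
      map_smul' := fun _ _ ↦ rfl }
    (Matrix.ext fun x y ↦ (IncidenceAlgebra.one_apply x y).trans Matrix.one_apply.symm)
    (fun f g ↦ Matrix.ext fun x y ↦
      (IncidenceAlgebra.mul_apply_univ f g x y).trans Matrix.mul_apply.symm)

lemma IncidenceAlgebra.toMatrix_apply (f : IncidenceAlgebra K P) (x y : P) :
    IncidenceAlgebra.toMatrix f x y = f x y := rfl

lemma IncidenceAlgebra.toMatrix_injective :
    Function.Injective (IncidenceAlgebra.toMatrix : IncidenceAlgebra K P →ₐ[K] Matrix P P K) :=
  fun _ _ h ↦ IncidenceAlgebra.ext fun x y _ ↦ congrFun₂ h x y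

lemma IncidenceAlgebra.exists_toMatrix_eq_single (x : P) :
    ∃ f : IncidenceAlgebra K P, IncidenceAlgebra.toMatrix f = Matrix.single x x 1 := by
  refine ⟨⟨fun a b ↦ Matrix.single x x 1 a b, fun a b h ↦ ?_⟩, rfl⟩
  rw [Matrix.single_apply, if_neg]
  rintro ⟨rfl, rfl⟩
  exact h le_rfl

end IncidenceMatrix

/-- An algebra of matrices containing the diagonal matrix units has a faithful thin module. -/
lemma exists_faithful_thin_of_matrix {K : Type*} [Field K] {A : Type v} [Ring A] [Algebra K A]
    {ι : Type*} [Fintype ι] [DecidableEq ι] (ρ : A →ₐ[K] Matrix ι ι K)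
    (hρ : Function.Injective ρ) (e : ι → A) (he : ∀ i, ρ (e i) = Matrix.single i i 1) :
    ∃ (M : Type v) (_ : AddCommGroup M) (_ : Module K M) (_ : Module A M)
      (_ : IsScalarTower K A M),
        Module.Finite K M ∧ FaithfulSMul A M ∧ IsThinModule A M := by
  have : Small.{v} (ι → K) := by
    by_cases hι : Nonempty ι
    · have : Nontrivial A := ρ.toRingHom.domain_nontrivial
      have : Small.{v} K := small_of_injective (algebraMap K A).injective
      obtain ⟨n, ⟨f⟩⟩ := Finite.exists_equiv_fin ι
      exact small_map (f.arrowCongr (Equiv.refl K))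
    · rw [not_nonempty_iff] at hι
      infer_instance
  let b : Basis ι K (Shrink.{v} (ι → K)) := Basis.ofEquivFun (Shrink.linearEquiv K (ι → K))
  let σ : A →ₐ[K] End K (Shrink.{v} (ι → K)) := (Matrix.toLinAlgEquiv b).toAlgHom.comp ρ
  have hσ : Function.Injective σ := (Matrix.toLinAlgEquiv b).injective.comp hρ
  let : Module A (Shrink.{v} (ι → K)) := Module.compHom _ σ.toRingHom
  have hsmul : ∀ (a : A) m, a • m = σ a m := fun _ _ ↦ rfl
  have hst : IsScalarTower K A (Shrink.{v} (ι → K)) :=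
    ⟨fun c a m ↦ by simp [hsmul]⟩
  have hfin : Module.Finite K (Shrink.{v} (ι → K)) := Module.Finite.of_basis b
  refine ⟨Shrink.{v} (ι → K), inferInstance, inferInstance, inferInstance, hst, hfin,
    ⟨fun h ↦ hσ (LinearMap.ext h)⟩, ?_⟩
  refine isThinModule_of_sum_eq_one (K := K)
    (isFiniteLength_iff_isNoetherian_isArtinian.mpr
      ⟨isNoetherian_of_tower K inferInstance, isArtinian_of_tower K inferInstance⟩) e ?_ b
      fun i m ↦ ⟨b.repr m i, ?_⟩
  · apply hρ
    rw [map_sum, map_one]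
    simp only [he]
    ext i j
    rw [Matrix.sum_apply, Finset.sum_eq_single i (fun k _ hk ↦ by simp [hk]) (by simp)]
    simp [Matrix.single_apply, Matrix.one_apply]
  · change Matrix.toLinAlgEquiv b (ρ (e i)) m = _
    rw [Matrix.toLinAlgEquiv_apply, he, Finset.sum_eq_single i]
    · simp [Matrix.single_mulVec]
    · intro j _ hj
      simp [Matrix.single_mulVec, hj]
    · simp

/-- An algebra of matrices containing the diagonal matrix units, in which no two opposite
off-diagonal entries are both attained, is an incidence algebra. -/
lemma exists_algEquiv_incidenceAlgebra_of_matrix {K A : Type*} [Field K] [Ring A] [Algebra K A]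
    {ι : Type} [Fintype ι] [DecidableEq ι] (ρ : A →ₐ[K] Matrix ι ι K)
    (hρ : Function.Injective ρ) (e : ι → A) (he : ∀ i, ρ (e i) = Matrix.single i i 1)
    (hanti : ∀ a b i j, ρ a i j ≠ 0 → ρ b j i ≠ 0 → i = j) :
    ∃ (P : Type) (_ : PartialOrder P) (_ : Fintype P) (_ : DecidableEq P)
      (_ : LocallyFiniteOrder P), Nonempty (A ≃ₐ[K] IncidenceAlgebra K P) := by
  classical
  let po : PartialOrder ι :=
    { le := fun i j ↦ ∃ a, ρ a i j ≠ 0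
      le_refl := fun i ↦ ⟨e i, by simp [he]⟩
      le_trans := by
        rintro i j k ⟨a, ha⟩ ⟨b, hb⟩
        refine ⟨e i * a * e j * (b * e k), ?_⟩
        have : ρ (e i * a * e j * (b * e k)) = Matrix.single i k (ρ a i j * ρ b j k) := by
          rw [map_mul, map_mul, map_mul, map_mul, he, he, he, ← mul_assoc,
            Matrix.single_mul_mul_single, Matrix.single_mul_mul_single]
          simp
        rw [this]
        simpa using ⟨ha, hb⟩
      le_antisymm := fun i j ⟨a, ha⟩ ⟨b, hb⟩ ↦ hanti a b i j ha hb }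
  have hle : ∀ i j : ι, i ≤ j ↔ ∃ a, ρ a i j ≠ 0 := fun _ _ ↦ Iff.rfl
  let lf : LocallyFiniteOrder ι := Fintype.toLocallyFiniteOrder
  refine ⟨ι, po, inferInstance, inferInstance, lf, ?_⟩
  have hrange : ρ.range = (IncidenceAlgebra.toMatrix (K := K) (P := ι)).range := by
    apply le_antisymm
    · rintro _ ⟨a, rfl⟩
      exact ⟨⟨fun i j ↦ ρ a i j, fun i j h ↦ by_contra fun h' ↦ h ⟨a, h'⟩⟩, rfl⟩
    · rintro _ ⟨f, rfl⟩
      change IncidenceAlgebra.toMatrix f ∈ _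
      rw [Matrix.matrix_eq_sum_single (IncidenceAlgebra.toMatrix f)]
      refine Subalgebra.sum_mem _ fun i _ ↦ Subalgebra.sum_mem _ fun j _ ↦ ?_
      rw [IncidenceAlgebra.toMatrix_apply]
      by_cases hij : i ≤ j
      · obtain ⟨a, ha⟩ := (hle i j).mp hij
        refine ⟨(f i j / ρ a i j) • (e i * a * e j), ?_⟩
        change ρ _ = _
        rw [map_smul, map_mul, map_mul, he, he, Matrix.single_mul_mul_single]
        simp [Matrix.smul_single, ha]
      · rw [IncidenceAlgebra.apply_eq_zero_of_not_le hij, Matrix.single_zero]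
        exact Subalgebra.zero_mem _
  exact ⟨(AlgEquiv.ofInjective ρ hρ).trans ((Subalgebra.equivOfEq _ _ hrange).trans
    (AlgEquiv.ofInjective _ IncidenceAlgebra.toMatrix_injective).symm)⟩

section Characters

variable {K A : Type*} [Field K] [Ring A] [Algebra K A]

lemma exists_algHom_smul_eq_of_finrank_eq_one {S : Type*} [AddCommGroup S] [Module K S]
    [Module A S] [IsScalarTower K A S] (hS : finrank K S = 1) :
    ∃ χ : A →ₐ[K] K, ∀ (a : A) (s : S), a • s = χ a • s := by
  have : Nontrivial S := nontrivial_of_finrank_pos (R := K) (by omega)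
  obtain ⟨v, hv⟩ := exists_ne (0 : S)
  have hspan := (finrank_eq_one_iff_of_nonzero' v hv).mp hS
  choose c hc using fun a : A ↦ hspan (a • v)
  have hinj := smul_left_injective K hv
  have hcs : ∀ (a : A) (s : S), a • s = c a • s := by
    intro a s
    obtain ⟨d, rfl⟩ := hspan s
    rw [smul_algebra_smul_comm, ← hc, smul_comm]
  refine ⟨AlgHom.ofLinearMap
    { toFun := c
      map_add' := fun a b ↦ hinj (by simp [hc, add_smul])
      map_smul' := fun k a ↦ hinj (by simp [hc, mul_smul]) }
    (hinj (by simp [hc])) (fun a b ↦ hinj ?_), hcs⟩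
  change c (a * b) • v = (c a * c b) • v
  rw [hc, mul_smul, hcs, hcs, smul_smul]

lemma nonempty_linearEquiv_of_smul_eq {S T : Type*} [AddCommGroup S] [Module K S]
    [Module A S] [AddCommGroup T] [Module K T] [Module A T]
    (hS : finrank K S = 1) (hT : finrank K T = 1) (χ : A →ₐ[K] K)
    (hχS : ∀ (a : A) (s : S), a • s = χ a • s) (hχT : ∀ (a : A) (t : T), a • t = χ a • t) :
    Nonempty (S ≃ₗ[A] T) := by
  have : Module.Finite K S := finite_of_finrank_pos (by omega)
  have : Module.Finite K T := finite_of_finrank_pos (by omega)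
  let f : S ≃ₗ[K] T := LinearEquiv.ofFinrankEq S T (hS.trans hT.symm)
  have hf : ∀ (a : A) (s : S), f (a • s) = a • f s := fun a s ↦ by rw [hχS, hχT, map_smul]
  exact ⟨{ f with map_smul' := hf }⟩

/-- Separation of finitely many distinct characters. -/
lemma exists_algHom_eq_one_and_eq_zero {ι : Type*} (χ : ι → A →ₐ[K] K)
    (hχ : Function.Injective χ) (i : ι) (s : Finset ι) (hi : i ∉ s) :
    ∃ a, χ i a = 1 ∧ ∀ j ∈ s, χ j a = 0 := by
  classical
  induction s using Finset.induction_on with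
  | empty => exact ⟨1, by simp, by simp⟩
  | insert j s hj ih =>
    rw [Finset.mem_insert, not_or] at hi
    obtain ⟨a, ha, ha'⟩ := ih hi.2
    obtain ⟨b, hb⟩ : ∃ b, χ i b ≠ χ j b := by
      by_contra! h
      exact hi.1 (hχ (AlgHom.ext h))
    have hb' : χ i b - χ j b ≠ 0 := sub_ne_zero.mpr hb
    refine ⟨a * ((χ i b - χ j b)⁻¹ • (b - algebraMap K A (χ j b))), ?_, ?_⟩
    · simp [ha, hb']
    · intro k hk
      rcases Finset.mem_insert.mp hk with rfl | hk
      · simp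
      · simp [ha' k hk]

end Characters

/-- A chain of submodules with one-dimensional quotients and pairwise distinct characters,
in a faithful module, gives a triangular matrix representation containing the diagonal matrix
units. -/
lemma exists_matrix_of_flag {K A M : Type*} [Field K] [Ring A] [Algebra K A]
    [AddCommGroup M] [Module K M] [Module A M] [IsScalarTower K A M] [FaithfulSMul A M]
    {n : ℕ} (N : Fin (n + 1) → Submodule A M) (hN : Monotone N) (h0 : N 0 = ⊥)
    (hlast : N (Fin.last n) = ⊤) (v : Fin n → M) (hv : ∀ i, v i ∈ N i.succ)
    (hv' : ∀ i, v i ∉ N i.castSucc)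
    (hspan : ∀ i, ∀ m ∈ N i.succ, ∃ c : K, m - c • v i ∈ N i.castSucc)
    (χ : Fin n → A →ₐ[K] K) (hχ : Function.Injective χ)
    (hact : ∀ i a, ∀ m ∈ N i.succ, a • m - χ i a • m ∈ N i.castSucc) :
    ∃ ρ : A →ₐ[K] Matrix (Fin n) (Fin n) K, Function.Injective ρ ∧
      (∃ e : Fin n → A, ∀ i, ρ (e i) = Matrix.single i i 1) ∧
      ∀ a i j, ρ a i j ≠ 0 → i ≤ j := by
  let X : A →ₐ[K] (Fin n → K) := AlgHom.pi χ
  have hX : ∀ a i, X a i = χ i a := fun _ _ ↦ rfl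
  have hnil : ∀ a ∈ RingHom.ker X.toRingHom, IsNilpotent a := by
    intro a ha
    have ha' : ∀ i, χ i a = 0 := fun i ↦ congrFun (show X a = 0 from ha) i
    have key : ∀ i : Fin (n + 1), ∀ m ∈ N i, a ^ (i : ℕ) • m = 0 := by
      intro i
      induction i using Fin.induction with
      | zero => intro m hm; simpa [h0] using hm
      | succ i ih =>
        intro m hm
        have h := ih _ (by simpa [ha'] using hact i a m hm)
        rw [Fin.val_succ, pow_succ, mul_smul]
        exact h
    refine ⟨n, FaithfulSMul.eq_of_smul_eq_smul (α := M) fun m ↦ ?_⟩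
    rw [zero_smul]
    simpa using key (Fin.last n) m (by simp [hlast])
  obtain ⟨e, he, hXe⟩ := CompleteOrthogonalIdempotents.lift_of_isNilpotent_ker X.toRingHom hnil
    (CompleteOrthogonalIdempotents.single fun _ : Fin n ↦ K) (fun i ↦ by
      obtain ⟨a, ha, ha'⟩ := exists_algHom_eq_one_and_eq_zero χ hχ i (Finset.univ.erase i)
        (by simp)
      refine ⟨a, funext fun j ↦ ?_⟩
      change χ j a = _
      by_cases hj : j = i
      · subst hj; simp [ha]
      · rw [ha' j (by simp [hj])]; simp [hj])
  have hχe : ∀ i, χ i (e i) = 1 := fun i ↦ by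
    have : X (e i) = Pi.single i 1 := congrFun hXe i
    rw [← hX, this, Pi.single_eq_same]
  let w : Fin n → M := fun i ↦ e i • v i
  have hew : ∀ i j, e i • w j = if i = j then w j else 0 := fun i j ↦ by
    simp only [w, ← mul_smul, he.mul_eq]
    split_ifs with h
    · rw [h]
    · rw [zero_smul]
  have hwv : ∀ i, w i - v i ∈ N i.castSucc := fun i ↦ by
    simpa [hχe] using hact i (e i) (v i) (hv i)
  have hw : ∀ i, w i ∈ N i.succ := fun i ↦ (N i.succ).smul_mem _ (hv i)
  have hw' : ∀ i, w i ∉ N i.castSucc := fun i h ↦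
    hv' i (by simpa using (N i.castSucc).sub_mem h (hwv i))
  have hli : LinearIndependent K w := by
    rw [Fintype.linearIndependent_iff]
    intro g hg i
    have h := congrArg (e i • ·) hg
    simp only [Finset.smul_sum, smul_zero, smul_algebra_smul_comm, hew] at h
    simp only [smul_ite, smul_zero, Finset.sum_ite_eq, Finset.mem_univ, if_true] at h
    refine (smul_eq_zero.mp h).resolve_right fun h' ↦ hw' i ?_
    rw [h']
    exact Submodule.zero_mem _
  have hsp : ∀ i : Fin (n + 1), ∀ m ∈ N i, m ∈ Submodule.span K (Set.range w) := by
    intro i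
    induction i using Fin.induction with
    | zero =>
      intro m hm
      rw [h0, Submodule.mem_bot] at hm
      rw [hm]
      exact Submodule.zero_mem _
    | succ i ih =>
      intro m hm
      obtain ⟨c, hc⟩ := hspan i m hm
      have h : m - c • w i ∈ N i.castSucc := by
        have := (N i.castSucc).sub_mem hc ((N i.castSucc).smul_of_tower_mem c (hwv i))
        rw [smul_sub] at this
        convert this using 1
        abel
      have := Submodule.add_mem _ (ih _ h)
        (Submodule.smul_mem _ c (Submodule.subset_span (Set.mem_range_self i)))
      simpa using this
  let b : Basis (Fin n) K M := Basis.mk hli fun m _ ↦ hsp (Fin.last n) m (by simp [hlast])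
  have hb : ∀ i, b i = w i := fun i ↦ by simp [b]
  let ρ : A →ₐ[K] Matrix (Fin n) (Fin n) K :=
    (LinearMap.toMatrixAlgEquiv b).toAlgHom.comp (Algebra.lsmul K K M)
  have hρ : ∀ a i j, ρ a i j = b.repr (a • w j) i := fun a i j ↦ by
    change LinearMap.toMatrixAlgEquiv b (Algebra.lsmul K K M a) i j = _
    rw [LinearMap.toMatrixAlgEquiv_apply, hb]
    rfl
  have hrepr : ∀ i m, e i • m = b.repr m i • w i := by
    intro i m
    conv_lhs => rw [← b.sum_repr m]
    simp only [Finset.smul_sum, smul_algebra_smul_comm, hb, hew]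
    simp
  refine ⟨ρ, ?_, ⟨e, fun i ↦ ?_⟩, fun a i j hij ↦ ?_⟩
  · intro a a' h
    refine FaithfulSMul.eq_of_smul_eq_smul (α := M) fun m ↦ ?_
    exact LinearMap.congr_fun ((LinearMap.toMatrixAlgEquiv b).injective h) m
  · ext j k
    rw [hρ, hew]
    split_ifs with h
    · subst h
      rw [← hb, b.repr_self]
      simp [Matrix.single_apply, Finsupp.single_apply]
    · simp [h]
  · by_contra! hlt
    apply hw' i
    have h1 : e i • a • w j ∈ N i.castSucc :=
      Submodule.smul_mem _ _ (Submodule.smul_mem _ _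
        (hN (by simpa [Fin.le_def] using hlt) (hw j)))
    rw [hrepr, ← hρ] at h1
    have h2 := (N i.castSucc).smul_of_tower_mem (ρ a i j)⁻¹ h1
    rwa [smul_smul, inv_mul_cancel₀ hij, one_smul] at h2

/-- A faithful thin module over an algebra whose simple modules are one-dimensional gives a
triangular matrix representation containing the diagonal matrix units. -/
lemma IsThinModule.exists_matrix {K : Type*} [Field K] {A : Type*} [Ring A] [Algebra K A]
    {M : Type v} [AddCommGroup M] [Module K M] [Module A M] [IsScalarTower K A M]
    [FaithfulSMul A M] (hM : IsThinModule A M)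
    (hpointed : ∀ (S : Type v) [AddCommGroup S] [Module K S] [Module A S]
      [IsScalarTower K A S], IsSimpleModule A S → finrank K S = 1) :
    ∃ (n : ℕ) (ρ : A →ₐ[K] Matrix (Fin n) (Fin n) K), Function.Injective ρ ∧
      (∃ e : Fin n → A, ∀ i, ρ (e i) = Matrix.single i i 1) ∧
      ∀ a i j, ρ a i j ≠ 0 → i ≤ j := by
  obtain ⟨s, hs0, hs1⟩ := isFiniteLength_iff_exists_compositionSeries.mp hM.1
  have hmono : Monotone s := s.strictMono.monotone
  have hle : ∀ i : Fin s.length, s i.castSucc ≤ s i.succ := fun i ↦ (s.step i).1.le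
  have hsimple : ∀ i : Fin s.length,
      IsSimpleModule A (↥(s i.succ) ⧸ Submodule.comap (s i.succ).subtype (s i.castSucc)) :=
    fun i ↦ (covBy_iff_quot_is_simple (hle i)).mp (s.step i)
  have hdim : ∀ i : Fin s.length,
      finrank K (↥(s i.succ) ⧸ Submodule.comap (s i.succ).subtype (s i.castSucc)) = 1 :=
    fun i ↦ hpointed _ (hsimple i)
  choose χ hχ using fun i ↦ exists_algHom_smul_eq_of_finrank_eq_one (A := A) (hdim i)
  have hne : ∀ i j, i < j → χ i ≠ χ j := by
    intro i j hij h
    obtain ⟨f⟩ := nonempty_linearEquiv_of_smul_eq (hdim i) (hdim j) (χ i) (hχ i) (h ▸ hχ j)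
    exact (hM.2 _ _ _ _ (hle i) (hmono (by simpa [Fin.le_def] using hij)) (hle j)
      (hsimple i) (hsimple j)).false f
  have hinj : Function.Injective χ := by
    intro i j h
    by_contra hij
    rcases lt_or_gt_of_ne hij with h' | h'
    · exact hne i j h' h
    · exact hne j i h' h.symm
  choose v hv hv' using fun i ↦ SetLike.exists_of_lt (s.step i).1
  refine ⟨s.length, exists_matrix_of_flag s hmono hs0 hs1 v hv hv' ?_ χ hinj ?_⟩
  · intro i m hm
    have hne0 : (Submodule.Quotient.mk ⟨v i, hv i⟩ :
        ↥(s i.succ) ⧸ Submodule.comap (s i.succ).subtype (s i.castSucc)) ≠ 0 := by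
      rw [ne_eq, Submodule.Quotient.mk_eq_zero]
      exact hv' i
    obtain ⟨c, hc⟩ := (finrank_eq_one_iff_of_nonzero' _ hne0).mp (hdim i)
      (Submodule.Quotient.mk ⟨m, hm⟩)
    rw [← Submodule.Quotient.mk_smul, eq_comm, Submodule.Quotient.eq] at hc
    exact ⟨c, hc⟩
  · intro i a m hm
    have h := hχ i a (Submodule.Quotient.mk ⟨m, hm⟩)
    rw [← Submodule.Quotient.mk_smul, ← Submodule.Quotient.mk_smul, Submodule.Quotient.eq] at h
    exact h

theorem isIncidenceAlgebra_iff_exists_faithful_thin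
    (K : Type u) [Field K] [Infinite K]
    (A : Type v) [Ring A] [Algebra K A] [FiniteDimensional K A]
    (hpointed : ∀ (S : Type v) [AddCommGroup S] [Module K S] [Module A S]
      [IsScalarTower K A S], IsSimpleModule A S → Module.finrank K S = 1) :
    (∃ (P : Type) (_ : PartialOrder P) (_ : Fintype P) (_ : DecidableEq P)
        (_ : LocallyFiniteOrder P), Nonempty (A ≃ₐ[K] IncidenceAlgebra K P)) ↔
      (∃ (M : Type v) (_ : AddCommGroup M) (_ : Module K M) (_ : Module A M)
          (_ : IsScalarTower K A M),
          Module.Finite K M ∧ FaithfulSMul A M ∧ IsThinModule A M) := by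
  constructor
  · rintro ⟨P, _, _, _, _, ⟨φ⟩⟩
    choose f hf using IncidenceAlgebra.exists_toMatrix_eq_single (K := K) (P := P)
    refine exists_faithful_thin_of_matrix (IncidenceAlgebra.toMatrix.comp φ.toAlgHom)
      (IncidenceAlgebra.toMatrix_injective.comp φ.injective) (fun x ↦ φ.symm (f x)) fun x ↦ ?_
    simp [hf]
  · rintro ⟨M, _, _, _, _, _, _, hM⟩
    obtain ⟨n, ρ, hρ, ⟨e, he⟩, hle⟩ := hM.exists_matrix hpointed
    exact exists_algEquiv_incidenceAlgebra_of_matrix ρ hρ e he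
      fun a b i j hij hji ↦ le_antisymm (hle a i j hij) (hle b j i hji)
end

section
/- Let K be an infinite field and A a finite-dimensional K-algebra such that every simple A-module is 1-dimensional over K. If M is a finite-dimensional thin A-module, then the quotient of A by the two-sided annihilator ideal of M is isomorphic as a K-algebra to the incidence algebra I(P,K) of some finite partial order P. -/
/-!
STATEMENT 14: Let `K` be an infinite field and `A` a finite-dimensional `K`-algebra
all of whose simple modules are 1-dimensional over `K`.  If `M` is a
finite-dimensional thin `A`-module, then `A` modulo the two-sided annihilator of `M`
is isomorphic as a `K`-algebra to the incidence algebra of some finite partial order.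
-/

universe u v w

/-- The annihilator `{a : A | ∀ m : M, a • m = 0}` of a module, as a two-sided ideal. -/
def annihilatorTwoSided (A : Type*) [Ring A] (M : Type*) [AddCommGroup M]
    [Module A M] : TwoSidedIdeal A :=
  TwoSidedIdeal.mk' {a : A | ∀ m : M, a • m = 0}
    (fun m => zero_smul A m)
    (fun {x y} hx hy m => by rw [add_smul, hx m, hy m, add_zero])
    (fun {x} hx m => by rw [neg_smul, hx m, neg_zero])
    (fun {x y} hy m => by rw [mul_smul, hy m, smul_zero])
    (fun {x y} hx m => by rw [mul_smul, hx (y • m)])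

/-- Two one-dimensional modules with the same character are isomorphic. -/
theorem nonempty_linearEquiv_of_character
    {K : Type u} [Field K] {A : Type v} [Ring A] {Q Q' : Type w} [AddCommGroup Q] [Module K Q] [Module A Q]
    [AddCommGroup Q'] [Module K Q'] [Module A Q']
    (hQ : Module.finrank K Q = 1) (hQ' : Module.finrank K Q' = 1)
    (χ : A → K) (h : ∀ (a : A) (q : Q), a • q = χ a • q)
    (h' : ∀ (a : A) (q : Q'), a • q = χ a • q) : Nonempty (Q ≃ₗ[A] Q') := by
  have := Module.finite_of_finrank_pos (R := K) (M := Q) (by omega)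
  have := Module.finite_of_finrank_pos (R := K) (M := Q') (by omega)
  let f := LinearEquiv.ofFinrankEq (R := K) Q Q' (hQ.trans hQ'.symm)
  exact ⟨{ f with map_smul' := fun a q => by simp [h, h'] }⟩

section Simple

variable {K : Type u} [Field K] {A : Type v} [Ring A] [Algebra K A]

/-- If every simple module in the universe of `A` is one-dimensional, then so is every simple
module in any universe. -/
theorem finrank_eq_one_of_isSimpleModule
    (hpointed : ∀ (S : Type v) [AddCommGroup S] [Module K S] [Module A S]
      [IsScalarTower K A S], IsSimpleModule A S → Module.finrank K S = 1)
    (Q : Type w) [AddCommGroup Q] [Module K Q] [Module A Q] [IsScalarTower K A Q]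
    [IsSimpleModule A Q] : Module.finrank K Q = 1 := by
  obtain ⟨I, hI, ⟨e⟩⟩ := isSimpleModule_iff_quot_maximal.mp ‹IsSimpleModule A Q›
  rw [(e.restrictScalars K).finrank_eq]
  exact hpointed _ (isSimpleModule_iff_quot_maximal.mpr ⟨I, hI, ⟨LinearEquiv.refl A _⟩⟩)

/-- An algebra acts on a one-dimensional module through a character. -/
theorem exists_character_of_finrank_eq_one
    (Q : Type w) [AddCommGroup Q] [Module K Q] [Module A Q] [IsScalarTower K A Q]
    (hQ : Module.finrank K Q = 1) :
    ∃ χ : A →ₐ[K] K, ∀ (a : A) (q : Q), a • q = χ a • q := by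
  have : Nontrivial Q := Module.nontrivial_of_finrank_pos (R := K) (by omega)
  have hbij : Function.Bijective (Algebra.ofId K (Module.End K Q)) := by
    refine ⟨(Algebra.ofId K (Module.End K Q)).toRingHom.injective, fun f => ?_⟩
    obtain ⟨v, hv, hspan⟩ := finrank_eq_one_iff'.mp hQ
    obtain ⟨c, hc⟩ := hspan (f v)
    refine ⟨c, LinearMap.ext fun q => ?_⟩
    obtain ⟨d, rfl⟩ := hspan q
    simp [Algebra.ofId_apply, Module.algebraMap_end_apply, ← hc]
  let e := AlgEquiv.ofBijective (Algebra.ofId K (Module.End K Q)) hbij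
  refine ⟨e.symm.toAlgHom.comp (Algebra.lsmul K K Q), fun a q => ?_⟩
  have h : e (e.symm (Algebra.lsmul K K Q a)) = Algebra.lsmul K K Q a := e.apply_symm_apply _
  exact (LinearMap.congr_fun h q).symm

/-- Over an infinite field, finitely many distinct characters are separated by one element. -/
theorem exists_injective_apply_of_injective [Infinite K] {ι : Type*} [Finite ι]
    (χ : ι → A →ₐ[K] K) (hχ : Function.Injective χ) :
    ∃ a : A, Function.Injective fun i => χ i a := by
  by_contra! hcon
  let p : {x : ι × ι // x.1 ≠ x.2} → Submodule K A := fun x =>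
    LinearMap.ker ((χ x.1.1).toLinearMap - (χ x.1.2).toLinearMap)
  obtain ⟨⟨⟨i, j⟩, hij⟩, h⟩ := Subspace.exists_eq_top_of_iUnion_eq_univ (p := p) <| by
    refine Set.eq_univ_of_forall fun a => ?_
    obtain ⟨i, j, h, hij⟩ := Function.not_injective_iff.mp (hcon a)
    exact Set.mem_iUnion.mpr ⟨⟨(i, j), hij⟩, by simpa [p, sub_eq_zero] using h⟩
  refine hij (hχ (AlgHom.ext fun a => ?_))
  have ha : a ∈ p ⟨(i, j), hij⟩ := h ▸ Submodule.mem_top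
  simpa [p, sub_eq_zero] using ha

end Simple

/-- A full flag of submodules on whose successive quotients `A` acts through the
characters `χ i`. -/
structure CharacterFlag (K : Type u) [Field K] (A : Type v) [Ring A] [Algebra K A]
    (M : Type w) [AddCommGroup M] [Module K M] [Module A M] (n : ℕ) where
  /-- The terms of the flag. -/
  term : Fin (n + 1) → Submodule A M
  /-- The characters of the successive quotients. -/
  χ : Fin n → A →ₐ[K] K
  term_zero : term 0 = ⊥
  term_last : term (Fin.last n) = ⊤
  le_succ : ∀ i : Fin n, term i.castSucc ≤ term i.succ
  smul_sub_mem : ∀ (i : Fin n) (a : A), ∀ m ∈ term i.succ, a • m - χ i a • m ∈ term i.castSucc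
  exists_generator : ∀ i : Fin n, ∃ v ∈ term i.succ, v ∉ term i.castSucc ∧
    ∀ m ∈ term i.succ, ∃ c : K, m - c • v ∈ term i.castSucc

section Thin

variable {K : Type u} [Field K] {A : Type v} [Ring A] [Algebra K A]
  {M : Type w} [AddCommGroup M] [Module K M] [Module A M] [IsScalarTower K A M]

theorem IsThinModule.exists_characterFlag
    (hpointed : ∀ (S : Type v) [AddCommGroup S] [Module K S] [Module A S]
      [IsScalarTower K A S], IsSimpleModule A S → Module.finrank K S = 1)
    (hthin : IsThinModule A M) :
    ∃ (n : ℕ) (F : CharacterFlag K A M n), Function.Injective F.χ := by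
  obtain ⟨s, hs0, hs1⟩ := isFiniteLength_iff_exists_compositionSeries.mp hthin.1
  have hmono : Monotone s := s.strictMono.monotone
  have hle (i : Fin s.length) : s i.castSucc ≤ s i.succ := (s.step i).le
  have hsimple (i : Fin s.length) :
      IsSimpleModule A (s i.succ ⧸ (s i.castSucc).comap (s i.succ).subtype) :=
    (covBy_iff_quot_is_simple (hle i)).mp (s.step i)
  have hrank (i : Fin s.length) :
      Module.finrank K (s i.succ ⧸ (s i.castSucc).comap (s i.succ).subtype) = 1 :=
    finrank_eq_one_of_isSimpleModule hpointed _
  choose χ hχ using fun i => exists_character_of_finrank_eq_one (A := A) _ (hrank i)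
  refine ⟨s.length, ⟨s, χ, hs0, hs1, hle, fun i a m hm => ?_, fun i => ?_⟩, ?_⟩
  · have h := hχ i a (Submodule.Quotient.mk ⟨m, hm⟩)
    rw [← Submodule.Quotient.mk_smul, ← Submodule.Quotient.mk_smul, Submodule.Quotient.eq] at h
    simpa using h
  · obtain ⟨q, hq, hspan⟩ := finrank_eq_one_iff'.mp (hrank i)
    obtain ⟨v, rfl⟩ := Submodule.Quotient.mk_surjective _ q
    refine ⟨v, v.2, fun hv => hq ?_, fun m hm => ?_⟩
    · rw [Submodule.Quotient.mk_eq_zero]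
      simpa using hv
    · obtain ⟨c, hc⟩ := hspan (Submodule.Quotient.mk ⟨m, hm⟩)
      rw [← Submodule.Quotient.mk_smul, eq_comm, Submodule.Quotient.eq] at hc
      exact ⟨c, by simpa using hc⟩
  · refine Function.Injective.of_lt_imp_ne fun i j hij heq => ?_
    have h := hthin.2 _ _ _ _ (hle i) (hmono (Fin.succ_le_castSucc_iff.mpr hij)) (hle j)
      (hsimple i) (hsimple j)
    obtain ⟨e⟩ := nonempty_linearEquiv_of_character (hrank i) (hrank j) (χ i) (hχ i)
      (fun a q => by rw [show χ i = χ j from heq]; exact hχ j a q)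
    exact h.false e

namespace CharacterFlag

variable {n : ℕ} (F : CharacterFlag K A M n) {a : A}

theorem smul_mem_iff (i : Fin n) {m : M} (hm : m ∈ F.term i.succ) (b : A) (hb : F.χ i b ≠ 0) :
    b • m ∈ F.term i.castSucc ↔ m ∈ F.term i.castSucc := by
  refine ⟨fun h => ?_, fun h => Submodule.smul_mem _ _ h⟩
  have h' := Submodule.sub_mem _ h (F.smul_sub_mem i b m hm)
  rw [sub_sub_cancel] at h'
  simpa [smul_smul, inv_mul_cancel₀ hb] using
    Submodule.smul_of_tower_mem (F.term i.castSucc) (F.χ i b)⁻¹ h'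

open Polynomial in
theorem exists_polynomial_annihilating (a : A) (k : Fin (n + 1)) :
    ∃ p : K[X], (∀ m ∈ F.term k, aeval a p • m = 0) ∧
      ∀ x, p.eval x = 0 → ∃ j : Fin n, j.castSucc < k ∧ x = F.χ j a := by
  induction k using Fin.induction with
  | zero => exact ⟨1, by simp [F.term_zero], by simp⟩
  | succ i ih =>
    obtain ⟨p, hp, hroot⟩ := ih
    refine ⟨p * (X - C (F.χ i a)), fun m hm => ?_, fun x hx => ?_⟩
    · rw [map_mul, mul_smul]
      refine hp _ ?_
      simpa [sub_smul] using F.smul_sub_mem i a m hm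
    · rw [eval_mul, mul_eq_zero] at hx
      rcases hx with hx | hx
      · obtain ⟨j, hj, rfl⟩ := hroot x hx
        exact ⟨j, hj.trans (Fin.castSucc_lt_succ), rfl⟩
      · exact ⟨i, Fin.castSucc_lt_succ, by simpa [sub_eq_zero] using hx⟩

theorem exists_eigenvector (ha : Function.Injective fun i => F.χ i a) (i : Fin n) :
    ∃ w ∈ F.term i.succ, w ∉ F.term i.castSucc ∧ a • w = F.χ i a • w := by
  obtain ⟨v, hv, hv', -⟩ := F.exists_generator i
  obtain ⟨p, hp, hroot⟩ := F.exists_polynomial_annihilating a i.castSucc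
  refine ⟨Polynomial.aeval a p • v, Submodule.smul_mem _ _ hv, ?_, ?_⟩
  · rwa [F.smul_mem_iff i hv]
    rw [← Polynomial.aeval_algHom_apply, Polynomial.coe_aeval_eq_eval]
    intro h0
    obtain ⟨j, hj, h⟩ := hroot _ h0
    exact hj.ne (congrArg Fin.castSucc (ha h).symm)
  · have h := hp _ (F.smul_sub_mem i a v hv)
    have hcomm : a * Polynomial.aeval a p = Polynomial.aeval a p * a := by
      simpa using congrArg (Polynomial.aeval a) (mul_comm Polynomial.X p)
    rwa [smul_sub, smul_smul, ← hcomm, mul_smul, smul_algebra_smul_comm, sub_eq_zero] at h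

theorem term_le_span {w : Fin n → M} (hw : ∀ i, w i ∈ F.term i.succ)
    (hw' : ∀ i, w i ∉ F.term i.castSucc) (k : Fin (n + 1)) :
    ∀ m ∈ F.term k, m ∈ Submodule.span K (w '' {i | i.castSucc < k}) := by
  induction k using Fin.induction with
  | zero => simp [F.term_zero]
  | succ i ih =>
    intro m hm
    obtain ⟨v, -, -, hgen⟩ := F.exists_generator i
    obtain ⟨c, hc⟩ := hgen _ (hw i)
    obtain ⟨d, hd⟩ := hgen m hm
    have hc0 : c ≠ 0 := by
      rintro rfl
      exact hw' i (by simpa using hc)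
    have hmem : m - (d * c⁻¹) • w i ∈ F.term i.castSucc := by
      have h := Submodule.sub_mem _ hd
        (Submodule.smul_of_tower_mem (F.term i.castSucc) (d * c⁻¹) hc)
      rw [smul_sub, smul_smul, inv_mul_cancel_right₀ hc0] at h
      simpa using h
    rw [← sub_add_cancel m ((d * c⁻¹) • w i)]
    refine Submodule.add_mem _ (Submodule.span_mono (Set.image_mono fun j hj => ?_) (ih _ hmem))
      (Submodule.smul_mem _ _ (Submodule.subset_span ⟨i, Fin.castSucc_lt_succ, rfl⟩))
    exact lt_trans hj Fin.castSucc_lt_succ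

/-- A flag with distinct characters admits a basis in which `A` acts by upper triangular
matrices and the diagonal matrix units are realised by elements of `A`. -/
theorem exists_basis [Infinite K] (hF : Function.Injective F.χ) :
    ∃ (w : Module.Basis (Fin n) K M) (e : Fin n → A),
      (∀ i j, e i • w j = if i = j then w j else 0) ∧
      ∀ (b : A) (i j : Fin n), w.repr (b • w j) i ≠ 0 → i ≤ j := by
  obtain ⟨a, ha⟩ := exists_injective_apply_of_injective F.χ hF
  choose w hw hw' heig using F.exists_eigenvector ha
  have hli : LinearIndependent K w := by
    refine Module.End.eigenvectors_linearIndependent' (Algebra.lsmul K K M a) _ ha w fun i => ?_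
    rw [Module.End.hasEigenvector_iff, Module.End.mem_eigenspace_iff]
    exact ⟨heig i, fun h => hw' i (h ▸ Submodule.zero_mem _)⟩
  have hspan : ⊤ ≤ Submodule.span K (Set.range w) := fun m _ =>
    Submodule.span_mono (Set.image_subset_range _ _)
      (F.term_le_span hw hw' (Fin.last n) m (F.term_last ▸ Submodule.mem_top))
  have haeval (p : Polynomial K) (j : Fin n) :
      Polynomial.aeval a p • w j = p.eval (F.χ j a) • w j := by
    induction p using Polynomial.induction_on' with
    | add p q hp hq => simp [add_smul, hp, hq]
    | monomial k c =>
      have hpow : a ^ k • w j = F.χ j a ^ k • w j := by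
        induction k with
        | zero => simp
        | succ k ih => rw [pow_succ, mul_smul, heig, smul_algebra_smul_comm, ih, smul_smul, pow_succ']
      simp [mul_smul, hpow, Polynomial.aeval_monomial]
  refine ⟨Module.Basis.mk hli hspan,
    fun i => Polynomial.aeval a (Lagrange.basis Finset.univ (fun i => F.χ i a) i),
    fun i j => ?_, fun b i j h => ?_⟩
  · rw [Module.Basis.mk_apply, haeval]
    split_ifs with hij
    · rw [← hij, Lagrange.eval_basis_self ha.injOn (Finset.mem_univ i), one_smul]
    · rw [Lagrange.eval_basis_of_ne (v := fun i => F.χ i a) hij (Finset.mem_univ j), zero_smul]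
  · have hmem := F.term_le_span hw hw' j.succ _ (Submodule.smul_mem _ b (hw j))
    have hcoe : w = Module.Basis.mk hli hspan := (Module.Basis.coe_mk hli hspan).symm
    rw [Module.Basis.mk_apply] at h
    nth_rewrite 1 [hcoe] at hmem
    have := (Module.Basis.mem_span_image _).mp hmem (Finsupp.mem_support_iff.mpr h)
    exact Fin.castSucc_lt_succ_iff.mp this

end CharacterFlag

end Thin

/-- A matrix representation whose image contains the diagonal matrix units and whose support is
antisymmetric maps onto the incidence algebra of its support. -/
theorem exists_surjective_incidenceAlgebra {K : Type u} [Field K] {A : Type v} [Ring A]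
    [Algebra K A] {ι : Type} [Fintype ι] [DecidableEq ι] (φ : A →ₐ[K] Matrix ι ι K)
    (e : ι → A) (he : ∀ i, φ (e i) = Matrix.single i i 1)
    (hanti : ∀ i j b c, φ b i j ≠ 0 → φ c j i ≠ 0 → i = j) :
    ∃ (_ : PartialOrder ι) (_ : LocallyFiniteOrder ι) (ψ : A →ₐ[K] IncidenceAlgebra K ι),
      Function.Surjective ψ ∧ ∀ b, ψ b = 0 ↔ φ b = 0 := by
  classical
  have hentry (b : A) (i j k l : ι) :
      φ (e i * b * e j) k l = if i = k ∧ j = l then φ b i j else 0 := by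
    simp [he, Matrix.single_apply]
  let order : PartialOrder ι :=
    { le := fun i j => ∃ b, φ b i j ≠ 0
      le_refl := fun i => ⟨1, by simp⟩
      le_trans := fun i j k ⟨b, hb⟩ ⟨c, hc⟩ => ⟨b * e j * c, by
        simpa [he, Matrix.mul_apply, Matrix.single_apply, ite_and] using And.intro hb hc⟩
      le_antisymm := fun i j ⟨b, hb⟩ ⟨c, hc⟩ => hanti i j b c hb hc }
  let lfo : LocallyFiniteOrder ι := Fintype.toLocallyFiniteOrder
  have hle {i j : ι} : i ≤ j ↔ ∃ b, φ b i j ≠ 0 := Iff.rfl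
  have hzero (b : A) {i j : ι} (h : ¬ i ≤ j) : φ b i j = 0 := by
    by_contra hb
    exact h (hle.mpr ⟨b, hb⟩)
  let ψ : A →ₗ[K] IncidenceAlgebra K ι :=
    { toFun := fun b => ⟨fun i j => φ b i j, fun i j h => hzero b h⟩
      map_add' := fun b c => by ext i j; simp [IncidenceAlgebra.add_apply]
      map_smul' := fun r b => by ext i j; simp [IncidenceAlgebra.constSMul_apply] }
  have hψ (b : A) (i j : ι) : ψ b i j = φ b i j := rfl
  refine ⟨order, lfo, AlgHom.ofLinearMap ψ ?_ ?_, ?_, fun b => ?_⟩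
  · ext i j
    simp [hψ, Matrix.one_apply]
  · intro b c
    ext i j
    rw [IncidenceAlgebra.mul_apply, hψ, map_mul, Matrix.mul_apply]
    refine (Finset.sum_subset (Finset.subset_univ _) fun k _ hk => ?_).symm
    rw [Finset.mem_Icc, not_and_or] at hk
    rcases hk with hk | hk
    · simp [hzero b hk]
    · simp [hzero c hk]
  · intro f
    have hunit (i j : ι) : ∃ b : A, ∀ k l, φ b k l = if i = k ∧ j = l then f i j else 0 := by
      by_cases hij : i ≤ j
      · obtain ⟨b, hb⟩ := hle.mp hij
        refine ⟨(f i j * (φ b i j)⁻¹) • (e i * b * e j), fun k l => ?_⟩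
        rw [map_smul, Matrix.smul_apply, hentry]
        split_ifs <;> simp [hb]
      · exact ⟨0, by simp [IncidenceAlgebra.apply_eq_zero_of_not_le hij]⟩
    choose u hu using hunit
    refine ⟨∑ i, ∑ j, u i j, ?_⟩
    ext k l
    rw [AlgHom.ofLinearMap_apply, hψ]
    simp [Matrix.sum_apply, hu, ite_and]
  · rw [AlgHom.ofLinearMap_apply]
    constructor
    · intro h
      ext i j
      rw [← hψ, h]
      rfl
    · intro h
      ext i j
      rw [hψ, h]
      rfl

theorem quotient_annihilator_isIncidenceAlgebra_of_thin
    (K : Type u) [Field K] [Infinite K]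
    (A : Type v) [Ring A] [Algebra K A] [FiniteDimensional K A]
    (hpointed : ∀ (S : Type v) [AddCommGroup S] [Module K S] [Module A S]
      [IsScalarTower K A S], IsSimpleModule A S → Module.finrank K S = 1)
    (M : Type w) [AddCommGroup M] [Module K M] [Module A M] [IsScalarTower K A M]
    [Module.Finite K M] (hthin : IsThinModule A M) :
    ∃ (P : Type) (_ : PartialOrder P) (_ : Fintype P) (_ : DecidableEq P)
        (_ : LocallyFiniteOrder P),
        Nonempty ((annihilatorTwoSided A M).ringCon.Quotient ≃ₐ[K] IncidenceAlgebra K P) := by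
  obtain ⟨n, F, hF⟩ := hthin.exists_characterFlag hpointed
  obtain ⟨w, e, he, htri⟩ := F.exists_basis hF
  let φ : A →ₐ[K] Matrix (Fin n) (Fin n) K :=
    (LinearMap.toMatrixAlgEquiv w).toAlgHom.comp (Algebra.lsmul K K M)
  have hφ (b : A) (i j : Fin n) : φ b i j = w.repr (b • w j) i :=
    LinearMap.toMatrixAlgEquiv_apply w _ i j
  have hker (b : A) : φ b = 0 ↔ ∀ m : M, b • m = 0 := by
    change LinearMap.toMatrixAlgEquiv w (Algebra.lsmul K K M b) = 0 ↔ _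
    rw [map_eq_zero_iff _ (LinearMap.toMatrixAlgEquiv w).injective, LinearMap.ext_iff]
    rfl
  obtain ⟨order, lfo, ψ, hsurj, hψ⟩ := exists_surjective_incidenceAlgebra φ e
    (fun i => by
      ext k l
      rw [hφ, he, Matrix.single_apply]
      by_cases hil : i = l
      · subst hil
        simp [Finsupp.single_apply]
      · simp [hil])
    (fun i j b c hb hc => le_antisymm (htri b i j (hφ b i j ▸ hb)) (htri c j i (hφ c j i ▸ hc)))
  have hrel (b c : A) : (annihilatorTwoSided A M).ringCon b c ↔ ψ b = ψ c := by
    rw [TwoSidedIdeal.rel_iff, annihilatorTwoSided, TwoSidedIdeal.mem_mk', ← sub_eq_zero (a := ψ b),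
      ← map_sub, hψ, hker]
    rfl
  refine ⟨Fin n, order, inferInstance, inferInstance, lfo,
    ⟨AlgEquiv.ofBijective
      (RingCon.liftₐ _ ψ fun b c h => (hrel b c).mp h) ⟨?_, fun f => ?_⟩⟩⟩
  · rintro ⟨b⟩ ⟨c⟩ h
    exact (RingCon.eq _).mpr ((hrel b c).mpr h)
  · obtain ⟨b, rfl⟩ := hsurj f
    exact ⟨(b : (annihilatorTwoSided A M).ringCon.Quotient), rfl⟩
end

section
/- Let K be a field and A a finite-dimensional K-algebra such that every simple A-module is 1-dimensional over K. Let P be a finitely generated indecomposable projective A-module such that for every quotient module P' of P the center of the quotient ring A/ann(P') is a semisimple ring, where ann(P') is the two-sided annihilator ideal of P'. Then every A-module endomorphism of P is multiplication by a scalar from K. -/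
/-!
STATEMENT 16: Let `K` be a field and `A` a finite-dimensional `K`-algebra all of
whose simple modules are 1-dimensional over `K`.  Let `P` be a finitely generated
indecomposable projective `A`-module such that for every quotient `P'` of `P` the
center of `A/ann(P')` is a semisimple ring.  Then every `A`-endomorphism of `P` is
multiplication by a scalar from `K`.
-/

universe u v w

/-- A module is indecomposable if it is nonzero and is not the internal direct sum of
two nonzero submodules. -/
def IsIndecomposableModule (R : Type*) [Ring R] (M : Type*) [AddCommGroup M]
    [Module R M] : Prop :=
  Nontrivial M ∧ ∀ N N' : Submodule R M, IsCompl N N' → N = ⊥ ∨ N' = ⊥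

open Submodule

/-- A semisimple ring has no nonzero central element of square zero. -/
theorem IsSemisimpleRing.eq_zero_of_forall_commute_of_mul_self {R : Type*} [Ring R]
    [IsSemisimpleRing R] {z : R} (hz : ∀ r, r * z = z * r) (hzz : z * z = 0) : z = 0 := by
  obtain ⟨J, hJ⟩ := exists_isCompl (span R {z})
  have h1 : (1 : R) ∈ span R {z} ⊔ J := hJ.sup_eq_top ▸ mem_top
  obtain ⟨a, ha, j, hj, haj⟩ := mem_sup.mp h1
  obtain ⟨r, rfl⟩ := mem_span_singleton.mp ha
  have hzj : z * j = 0 := by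
    have h : z * j ∈ span R {z} ⊓ J :=
      ⟨mem_span_singleton.mpr ⟨j, hz j⟩, J.smul_mem z hj⟩
    rwa [hJ.inf_eq_bot, mem_bot] at h
  calc z = z * (r • z + j) := by rw [haj, mul_one]
    _ = 0 := by
      rw [mul_add, hzj, add_zero, smul_eq_mul, hz r, ← mul_assoc, hzz, zero_mul]

/-- If `A / ann(P')` has semisimple center, an element of `A` acting on `P'` centrally and with
square zero acts as zero. -/
theorem smul_eq_zero_of_isSemisimpleRing_center {A M : Type*} [Ring A] [AddCommGroup M]
    [Module A M]
    (hss : IsSemisimpleRing (Subring.center ((annihilatorTwoSided A M).ringCon.Quotient)))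
    {z : A} (hz : ∀ (a : A) (x : M), a • z • x = z • a • x) (hzz : ∀ x : M, z • z • x = 0)
    (x : M) : z • x = 0 := by
  have key (a b : A) : ((a : (annihilatorTwoSided A M).ringCon.Quotient) = b) ↔
      ∀ x : M, a • x = b • x := by
    rw [RingCon.eq, TwoSidedIdeal.rel_iff]
    refine (TwoSidedIdeal.mem_mk' _ _ _ _ _ _ _).trans ?_
    simp [sub_smul, sub_eq_zero]
  have hc : (z : (annihilatorTwoSided A M).ringCon.Quotient) ∈ Subring.center _ := by
    rw [Subring.mem_center_iff]
    intro g
    obtain ⟨a, rfl⟩ := (annihilatorTwoSided A M).ringCon.mk'_surjective g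
    change (a : (annihilatorTwoSided A M).ringCon.Quotient) * z = z * a
    rw [← RingCon.coe_mul, ← RingCon.coe_mul, key]
    intro x
    rw [mul_smul, mul_smul, hz]
  have h0 := IsSemisimpleRing.eq_zero_of_forall_commute_of_mul_self
    (z := (⟨_, hc⟩ : Subring.center ((annihilatorTwoSided A M).ringCon.Quotient)))
    (fun r => Subtype.ext (r.2.comm _))
    (Subtype.ext (by
      change (z : (annihilatorTwoSided A M).ringCon.Quotient) * z = (0 : A)
      rw [← RingCon.coe_mul, key]
      intro x
      rw [mul_smul, hzz, zero_smul]))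
  have h1 := (key z 0).mp (congrArg Subtype.val h0)
  rw [h1, zero_smul]

/-- Let `F` split the surjection `A → P`, `a ↦ a • p`, let `M` be the largest proper submodule
of `P`, and suppose `P = K p + M`. If the centers of all `A / ann(P / N)` are semisimple,
then the idempotent `F p` annihilates `M`. -/
theorem smul_eq_zero_of_isSemisimpleRing_center_quotient {K A P : Type*} [Field K] [Ring A]
    [Algebra K A] [AddCommGroup P] [Module A P] [IsNoetherian A P] {p : P} (F : P →ₗ[A] A)
    (hF : ∀ x, F x • p = x) {M : Submodule A P} (hpM : p ∉ M)
    (hmax : ∀ N : Submodule A P, ¬ N ≤ M → N = ⊤)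
    (hK : ∀ x : P, ∃ c : K, x - algebraMap K A c • p ∈ M)
    (hcenter : ∀ N : Submodule A P,
      IsSemisimpleRing (Subring.center ((annihilatorTwoSided A (P ⧸ N)).ringCon.Quotient)))
    {m : P} (hm : m ∈ M) : F p • m = 0 := by
  by_contra hne
  obtain ⟨N, hN, hNmax⟩ := set_has_maximal_iff_noetherian.mpr ‹IsNoetherian A P›
    {N : Submodule A P | ∃ m ∈ M, F p • m ∉ N} ⟨⊥, m, hm, by simpa using hne⟩
  obtain ⟨m₀, hm₀, hm₀N⟩ := hN
  have hMM : ∀ x ∈ M, ∀ y ∈ M, F y • x ∈ N := by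
    intro x hx
    let h : P →ₗ[A] P := F.smulRight x
    by_contra! hcon
    obtain ⟨y, hy, hyN⟩ := hcon
    have hlt : N < N ⊔ M.map h := by
      refine lt_of_le_of_ne le_sup_left fun heq => hyN ?_
      rw [heq]
      exact mem_sup_right ⟨y, hy, rfl⟩
    have hx' : F p • x ∈ N ⊔ M.map h := by
      by_contra hx'
      exact hNmax _ ⟨x, hx, hx'⟩ hlt
    obtain ⟨n, hn, _, ⟨m', hm', rfl⟩, hsum⟩ := mem_sup.mp hx'
    have htop : N.comap h = ⊤ := by
      refine hmax _ fun hle => hpM ?_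
      have h1 : p - m' ∈ M := hle (by
        have : h (p - m') = n := by
          rw [map_sub, sub_eq_iff_eq_add, hsum]; rfl
        rwa [mem_comap, this])
      simpa using M.add_mem h1 hm'
    have : y ∈ N.comap h := htop ▸ mem_top
    exact hyN this
  have hzM : F p • m₀ ∈ M := M.smul_mem _ hm₀
  obtain ⟨z, hzp, hzN⟩ : ∃ z : A, z • p = F p • m₀ ∧ ∀ x ∈ M, z • x ∈ N :=
    ⟨F (F p • m₀), hF _, fun x hx => hMM x hx _ hzM⟩
  have hsub (a : A) (x : P) (hx : x ∈ M) :
      a • z • x - z • a • x ∈ N :=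
    N.sub_mem (N.smul_mem _ (hzN x hx)) (hzN _ (M.smul_mem _ hx))
  have hKc (c : K) (a : A) (x : P) : algebraMap K A c • a • x = a • algebraMap K A c • x := by
    rw [← mul_smul, ← mul_smul, Algebra.commutes]
  have hsubp (a : A) : a • z • p - z • a • p ∈ N := by
    obtain ⟨c, hc⟩ := hK (a • p)
    have h1 := N.sub_mem (hMM m₀ hm₀ _ hc) (hzN _ hc)
    convert h1 using 1
    simp only [map_sub, map_smul, sub_smul, smul_sub, smul_assoc, ← hzp, hKc]
    abel
  have hcomm (a : A) (x : P) : a • z • x - z • a • x ∈ N := by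
    obtain ⟨c, hc⟩ := hK x
    have h1 := N.add_mem (hsub a _ hc) (N.smul_mem (algebraMap K A c) (hsubp a))
    convert h1 using 1
    simp only [smul_sub, hKc]
    abel
  have hsq (x : P) : z • z • x ∈ N := by
    obtain ⟨c, hc⟩ := hK x
    have h1 := N.add_mem (N.smul_mem z (hzN _ hc))
      (N.smul_mem (algebraMap K A c) (hzN _ hzM))
    convert h1 using 1
    simp only [smul_sub, ← hzp, hKc]
    abel
  have h0 := smul_eq_zero_of_isSemisimpleRing_center (hcenter N) (z := z)
    (fun a x => by
      induction x using Submodule.Quotient.induction_on with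
      | _ x => exact (Submodule.Quotient.eq N).mpr (hcomm a x))
    (fun x => by
      induction x using Submodule.Quotient.induction_on with
      | _ x => exact (Submodule.Quotient.mk_eq_zero N).mpr (hsq x))
    (Submodule.Quotient.mk p)
  rw [← Submodule.Quotient.mk_smul, hzp, Submodule.Quotient.mk_eq_zero] at h0
  exact hm₀N h0

/-- An endomorphism of an indecomposable module of finite length which is the identity modulo a
proper submodule is bijective. -/
theorem IsIndecomposableModule.bijective_of_sub_mem {A P : Type*} [Ring A] [AddCommGroup P]
    [Module A P] [IsArtinian A P] [IsNoetherian A P] (hP : IsIndecomposableModule A P)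
    {M : Submodule A P} (hM : M ≠ ⊤) {θ : Module.End A P} (hθ : ∀ x, θ x - x ∈ M) :
    Function.Bijective θ := by
  have hpow (n : ℕ) (x : P) : (θ ^ n) x - x ∈ M := by
    induction n with
    | zero => simp
    | succ n ih =>
      rw [pow_succ', Module.End.mul_apply]
      simpa using M.add_mem (hθ ((θ ^ n) x)) ih
  obtain ⟨n, hn⟩ := Filter.eventually_atTop.mp θ.eventually_isCompl_ker_pow_range_pow
  have hcompl := hn (n + 1) (Nat.le_succ n)
  refine IsArtinian.bijective_of_injective_endomorphism θ ?_
  rcases hP.2 _ _ hcompl with h | h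
  · have hinj := LinearMap.ker_eq_bot.mp h
    rw [pow_succ] at hinj
    exact Function.Injective.of_comp (f := (θ ^ n : Module.End A P)) hinj
  · refine absurd ?_ hM
    rw [eq_top_iff]
    intro x _
    have hx := hpow (n + 1) x
    rw [LinearMap.range_eq_bot.mp h] at hx
    simpa using hx

theorem endomorphism_scalar_of_semisimple_centers
    (K : Type u) [Field K]
    (A : Type v) [Ring A] [Algebra K A] [FiniteDimensional K A]
    (hpointed : ∀ (S : Type v) [AddCommGroup S] [Module K S] [Module A S]
      [IsScalarTower K A S], IsSimpleModule A S → Module.finrank K S = 1)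
    (P : Type w) [AddCommGroup P] [Module A P] [Module.Finite A P]
    (hproj : Module.Projective A P)
    (hindec : IsIndecomposableModule A P)
    (hcenter : ∀ N : Submodule A P,
      IsSemisimpleRing (Subring.center ((annihilatorTwoSided A (P ⧸ N)).ringCon.Quotient)))
    (φ : P →ₗ[A] P) :
    ∃ c : K, ∀ x : P, φ x = algebraMap K A c • x := by
  have : Nontrivial P := hindec.1
  have : IsArtinianRing A := isArtinian_of_tower K inferInstance
  obtain ⟨M, hM, -⟩ := (eq_top_or_exists_le_coatom (⊥ : Submodule A P)).resolve_left bot_ne_top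
  obtain ⟨p, -, hpM⟩ := SetLike.exists_of_lt hM.lt_top
  have : IsSimpleModule A (P ⧸ M) := isSimpleModule_iff_isCoatom.mpr hM
  let q : A →ₗ[A] P ⧸ M := LinearMap.toSpanSingleton A _ (Submodule.Quotient.mk p)
  have hq : Function.Surjective q := by
    refine LinearMap.surjective_of_ne_zero fun h => hpM ?_
    have := LinearMap.congr_fun h 1
    simpa [q] using this
  have hS := hpointed (A ⧸ LinearMap.ker q)
    (.congr (LinearMap.quotKerEquivOfSurjective q hq))
  have hmax (N : Submodule A P) (hN : ¬ N ≤ M) : N = ⊤ := by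
    have hr : Function.Surjective (M.mkQ ∘ₗ N.subtype) := by
      refine LinearMap.surjective_of_ne_zero fun h => hN fun x hx => ?_
      simpa using LinearMap.congr_fun h ⟨x, hx⟩
    obtain ⟨h, hh⟩ := Module.projective_lifting_property _ M.mkQ hr
    have hbij := hindec.bijective_of_sub_mem hM.1 (θ := N.subtype ∘ₗ h) fun x => by
      rw [← Submodule.Quotient.eq]
      exact LinearMap.congr_fun hh x
    rw [eq_top_iff]
    intro x _
    obtain ⟨y, rfl⟩ := hbij.2 x
    exact (h y).2
  obtain ⟨f, hf⟩ := Module.projective_lifting_property q M.mkQ hq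
  have hbij := hindec.bijective_of_sub_mem hM.1
    (θ := LinearMap.toSpanSingleton A P p ∘ₗ f) fun x => by
      rw [← Submodule.Quotient.eq]
      exact LinearMap.congr_fun hf x
  let F : P →ₗ[A] A := f ∘ₗ (LinearEquiv.ofBijective _ hbij).symm.toLinearMap
  have hF (x : P) : F x • p = x := (LinearEquiv.ofBijective _ hbij).apply_symm_apply x
  have hK (x : P) : ∃ c : K, x - algebraMap K A c • p ∈ M := by
    have h1 : (Submodule.Quotient.mk 1 : A ⧸ LinearMap.ker q) ≠ 0 := by
      rw [Ne, Submodule.Quotient.mk_eq_zero]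
      simpa [q] using hpM
    obtain ⟨c, hc⟩ := exists_smul_eq_of_finrank_eq_one hS h1
      (Submodule.Quotient.mk (F x))
    refine ⟨c, ?_⟩
    rw [← Submodule.Quotient.mk_smul, eq_comm, Submodule.Quotient.eq, LinearMap.mem_ker,
      Algebra.smul_def, mul_one] at hc
    have hc' : (Submodule.Quotient.mk ((F x - algebraMap K A c) • p) : P ⧸ M) = 0 := hc
    rwa [sub_smul, hF, Submodule.Quotient.mk_eq_zero] at hc'
  obtain ⟨c, hc⟩ := hK (φ p)
  have hp := smul_eq_zero_of_isSemisimpleRing_center_quotient F hF hpM hmax hK hcenter hc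
  rw [smul_sub, ← mul_smul, ← Algebra.commutes, mul_smul, hF, ← map_smul, hF, sub_eq_zero] at hp
  refine ⟨c, fun x => ?_⟩
  rw [← hF x, map_smul, hp, ← mul_smul, ← mul_smul, Algebra.commutes]
end
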